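/- arXiv:1310.1773 — 4 statements merged into one kernel-verified Lean document; each statement's English description precedes it below -/
import Mathlib

section
/- Let n ≥ 1 and let b_1, c_1, …, b_n, c_n be 2n complex numbers that are algebraically independent over ℚ. Then the element τ = ∑_{i=1}^n D b_i ∧ D c_i of ⋀²Ω¹_{ℂ/ℚ} has weight w(τ) = n. -/
/-- The weight `w(τ)` of an element `τ` of the second exterior power `⋀²Ω¹_{ℂ/ℚ}`:
the least `n` such that `τ = ∑_{i=1}^n a_i • (D b_i ∧ D c_i)` for some `a_i, b_i, c_i ∈ ℂ`. -/
noncomputable def weight (τ : ⋀[ℂ]^2 (KaehlerDifferential ℚ ℂ)) : ℕ :=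
  sInf {n : ℕ | ∃ a b c : Fin n → ℂ,
    (τ : ExteriorAlgebra ℂ (KaehlerDifferential ℚ ℂ)) =
      ∑ i, a i • (ExteriorAlgebra.ι ℂ (KaehlerDifferential.D ℚ ℂ (b i)) *
        ExteriorAlgebra.ι ℂ (KaehlerDifferential.D ℚ ℂ (c i)))}

open scoped TensorProduct in
/-- A transcendence basis gives linearly independent differentials (characteristic zero). -/
theorem linearIndependent_D_of_isTranscendenceBasis {F E ι : Type*} [Field F] [Field E]
    [Algebra F E] [CharZero F] (x : ι → E) (hx : IsTranscendenceBasis F x) :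
    LinearIndependent E (fun i => KaehlerDifferential.D F E (x i)) := by
  let alg : Algebra (MvPolynomial ι F) E := (MvPolynomial.aeval x).toRingHom.toAlgebra
  have hmap : ∀ p, algebraMap (MvPolynomial ι F) E p = MvPolynomial.aeval x p := fun p => rfl
  have tow : IsScalarTower F (MvPolynomial ι F) E :=
    IsScalarTower.of_algebraMap_eq fun r => by simp [hmap]
  have hinj : Function.Injective (algebraMap (MvPolynomial ι F) E) := hx.1
  have : FaithfulSMul (MvPolynomial ι F) E := (faithfulSMul_iff_algebraMap_injective _ _).2 hinj
  have halg : Algebra.IsAlgebraic (MvPolynomial ι F) E := by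
    have := hx.isAlgebraic
    refine Algebra.IsAlgebraic.of_ringHom_of_comp_eq (S := Algebra.adjoin F (Set.range x)) (B := E)
      hx.1.aevalEquiv.toRingHom (RingHom.id E) hx.1.aevalEquiv.surjective
      Function.injective_id ?_
    ext p <;> simp [hmap]
  let : Algebra (FractionRing (MvPolynomial ι F)) E := FractionRing.liftAlgebra _ _
  have := FractionRing.isScalarTower_liftAlgebra (MvPolynomial ι F) E
  have : CharZero (FractionRing (MvPolynomial ι F)) :=
    charZero_of_injective_algebraMap (algebraMap F (FractionRing (MvPolynomial ι F))).injective
  have : Algebra.IsAlgebraic (FractionRing (MvPolynomial ι F)) E :=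
    (IsFractionRing.comap_isAlgebraic_iff (A := MvPolynomial ι F)).1 halg
  have : Algebra.FormallyEtale (FractionRing (MvPolynomial ι F)) E :=
    Algebra.FormallyEtale.of_isSeparable _ E
  have : Algebra.FormallyEtale (MvPolynomial ι F) (FractionRing (MvPolynomial ι F)) :=
    .of_isLocalization (nonZeroDivisors _)
  have : Algebra.FormallyEtale (MvPolynomial ι F) E :=
    .comp _ (FractionRing (MvPolynomial ι F)) _
  have h := (((KaehlerDifferential.mvPolynomialBasis F ι).baseChange E).map
    (KaehlerDifferential.tensorKaehlerEquivOfFormallyEtale F (MvPolynomial ι F) E)).linearIndependent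
  convert h using 2 with i
  simp [hmap]

theorem linearIndependent_D {F E ι : Type*} [Field F] [Field E]
    [Algebra F E] [CharZero F] (x : ι → E) (hx : AlgebraicIndependent F x) :
    LinearIndependent E (fun i => KaehlerDifferential.D F E (x i)) := by
  obtain ⟨t, hst, ht⟩ := exists_isTranscendenceBasis_superset hx.coe_range
  have h := linearIndependent_D_of_isTranscendenceBasis _ ht
  exact h.comp (fun i : ι => (⟨x i, hst ⟨i, rfl⟩⟩ : t))
    fun i j hij => hx.injective (congrArg Subtype.val hij)

/-- Contraction of a product of two vectors in the exterior algebra. -/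
theorem contract_mul {K V : Type*} [Field K] [AddCommGroup V] [Module K V]
    (d : Module.Dual K V) (u v : V) :
    CliffordAlgebra.contractLeft (Q := (0 : QuadraticForm K V)) d
      (ExteriorAlgebra.ι K u * ExteriorAlgebra.ι K v) =
      ExteriorAlgebra.ι K (d u • v - d v • u) := by
  unfold ExteriorAlgebra.ι
  rw [CliffordAlgebra.contractLeft_ι_mul, CliffordAlgebra.contractLeft_ι, map_sub, map_smul,
    map_smul, ← Algebra.commutes, ← Algebra.smul_def]

/-- The rank bound: a nondegenerate two-form in `2n` vectors is not a sum of fewer than `n`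
decomposables. -/
theorem le_of_sum_eq {K V : Type*} [Field K] [AddCommGroup V] [Module K V] {n m : ℕ}
    (u v : Fin n → V) (h : LinearIndependent K (Sum.elim u v))
    (a : Fin m → K) (p q : Fin m → V)
    (heq : ∑ i, ExteriorAlgebra.ι K (u i) * ExteriorAlgebra.ι K (v i) =
      ∑ i, a i • (ExteriorAlgebra.ι K (p i) * ExteriorAlgebra.ι K (q i))) : n ≤ m := by
  classical
  have key : ∀ d : Module.Dual K V, ∑ i, (d (u i) • v i - d (v i) • u i) =
      ∑ i, a i • (d (p i) • q i - d (q i) • p i) := by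
    intro d
    have h2 := congrArg (CliffordAlgebra.contractLeft (Q := (0 : QuadraticForm K V)) d) heq
    simp only [map_sum, map_smul] at h2
    simp only [contract_mul, ← map_smul, ← map_sum] at h2
    exact ExteriorAlgebra.ι_leftInverse.injective h2
  set W := Submodule.span K (Set.range (Sum.elim p q)) with hW
  have hp : ∀ i, p i ∈ W := fun i => Submodule.subset_span ⟨Sum.inl i, rfl⟩
  have hq : ∀ i, q i ∈ W := fun i => Submodule.subset_span ⟨Sum.inr i, rfl⟩
  have hmem : ∀ d : Module.Dual K V, ∑ i, (d (u i) • v i - d (v i) • u i) ∈ W := by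
    intro d
    rw [key]
    exact W.sum_mem fun i _ => W.smul_mem _
      (W.sub_mem (W.smul_mem _ (hq i)) (W.smul_mem _ (hp i)))
  have hdual : ∀ k : Fin n ⊕ Fin n, ∃ d : Module.Dual K V,
      ∀ l, d (Sum.elim u v l) = if l = k then 1 else 0 := by
    intro k
    obtain ⟨d, hd⟩ := LinearMap.exists_extend ((Finsupp.lapply k).comp h.repr)
    refine ⟨d, fun l => ?_⟩
    have hl : Sum.elim u v l ∈ Submodule.span K (Set.range (Sum.elim u v)) :=
      Submodule.subset_span ⟨l, rfl⟩
    have := LinearMap.congr_fun hd ⟨_, hl⟩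
    simp only [LinearMap.comp_apply, Submodule.subtype_apply] at this
    rw [this, h.repr_eq_single l ⟨_, hl⟩ rfl]
    simp [Finsupp.single_apply]
  have hall : ∀ k, Sum.elim u v k ∈ W := by
    rintro (k | k)
    · obtain ⟨d, hd⟩ := hdual (Sum.inr k)
      have hu : ∀ i, d (u i) = 0 := fun i => by simpa using hd (Sum.inl i)
      have hv : ∀ i, d (v i) = if i = k then 1 else 0 := fun i => by simpa using hd (Sum.inr i)
      have := hmem d
      simpa [hu, hv] using this
    · obtain ⟨d, hd⟩ := hdual (Sum.inl k)
      have hu : ∀ i, d (u i) = if i = k then 1 else 0 := fun i => by simpa using hd (Sum.inl i)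
      have hv : ∀ i, d (v i) = 0 := fun i => by simpa using hd (Sum.inr i)
      have := hmem d
      simpa [hu, hv] using this
  have h1 : Fintype.card (Fin n ⊕ Fin n) ≤ Module.finrank K W := by
    rw [← finrank_span_eq_card h]
    have : FiniteDimensional K W := FiniteDimensional.span_of_finite K (Set.finite_range _)
    apply Submodule.finrank_mono
    rw [Submodule.span_le]
    rintro _ ⟨k, rfl⟩
    exact hall k
  have h2 : Module.finrank K W ≤ Fintype.card (Fin m ⊕ Fin m) := finrank_range_le_card _
  simp only [Fintype.card_sum, Fintype.card_fin] at h1 h2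
  omega

/-- Lemma B.1 of the paper: if `b_1, c_1, …, b_n, c_n` are `2n` complex numbers which are
algebraically independent over `ℚ`, then `τ = ∑_{i=1}^n D b_i ∧ D c_i` has weight exactly `n`. -/
theorem weight_eq_of_algebraicIndependent (n : ℕ) (hn : 1 ≤ n) (b c : Fin n → ℂ)
    (hind : AlgebraicIndependent ℚ (Sum.elim b c))
    (τ : ⋀[ℂ]^2 (KaehlerDifferential ℚ ℂ))
    (hτ : (τ : ExteriorAlgebra ℂ (KaehlerDifferential ℚ ℂ)) =
      ∑ i, ExteriorAlgebra.ι ℂ (KaehlerDifferential.D ℚ ℂ (b i)) *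
        ExteriorAlgebra.ι ℂ (KaehlerDifferential.D ℚ ℂ (c i))) :
    weight τ = n := by
  have hlin : LinearIndependent ℂ (Sum.elim (fun i => KaehlerDifferential.D ℚ ℂ (b i))
      (fun i => KaehlerDifferential.D ℚ ℂ (c i))) := by
    have e : Sum.elim (fun i => KaehlerDifferential.D ℚ ℂ (b i))
        (fun i => KaehlerDifferential.D ℚ ℂ (c i)) =
        fun k => KaehlerDifferential.D ℚ ℂ (Sum.elim b c k) := by
      funext k
      rcases k with k | k <;> rfl
    rw [e]
    exact linearIndependent_D _ hind
  unfold weight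
  apply le_antisymm
  · apply Nat.sInf_le
    exact ⟨fun _ => 1, b, c, by simpa using hτ⟩
  · apply le_csInf
    · exact ⟨n, fun _ => 1, b, c, by simpa using hτ⟩
    · rintro m ⟨a, p, q, hm⟩
      exact le_of_sum_eq _ _ hlin a _ _ (hτ.symm.trans hm)
end

section
/- Let R be a commutative ring, M an R-module, n ≥ 1, and x, y : Fin n → M. In the exterior algebra ⋀ M over R one has the identity (∑_{i=1}^n ι(x_i) * ι(y_i))^n = n! • ∏_{i=1}^n (ι(x_i) * ι(y_i)), where ι : M → ⋀ M is the canonical inclusion and the product on the right is taken in the order i = 1, …, n (the degree-two factors ι(x_i)ι(y_i) commute with each other, so the order is immaterial). -/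
theorem sq_zero_add_pow {A : Type*} [Ring A] (a S : A) (ha : a * a = 0) (h : Commute a S)
    (k : ℕ) : (a + S) ^ (k + 1) = S ^ (k + 1) + (k + 1) • (a * S ^ k) := by
  induction k with
  | zero => simp [add_comm]
  | succ k ih =>
    have h1 : a * S ^ (k + 1) = S ^ (k + 1) * a := (h.pow_right (k + 1)).eq
    have h2 : a * S ^ k * a = 0 := by
      rw [mul_assoc, ← (h.pow_right k).eq, ← mul_assoc, ha, zero_mul]
    rw [pow_succ, ih, add_mul, mul_add, ← h1, smul_mul_assoc, mul_add, h2, zero_add, mul_assoc,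
      ← pow_succ, ← pow_succ, succ_nsmul _ (k + 1)]
    abel

theorem sum_pow_of_sq_zero {A : Type*} [Ring A] (n : ℕ) (a : Fin n → A)
    (hs : ∀ i, a i * a i = 0) (hc : ∀ i j, Commute (a i) (a j)) :
    (∑ i, a i) ^ n = n.factorial • (List.ofFn a).prod ∧ (∑ i, a i) ^ (n + 1) = 0 := by
  induction n with
  | zero => simp
  | succ n ih =>
    obtain ⟨h1, h2⟩ := ih (fun i => a i.succ) (fun i => hs _) (fun i j => hc _ _)
    have hC : Commute (a 0) (∑ i : Fin n, a i.succ) :=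
      Commute.sum_right _ _ _ fun i _ => hc _ _
    rw [Fin.sum_univ_succ, sq_zero_add_pow _ _ (hs 0) hC, sq_zero_add_pow _ _ (hs 0) hC]
    constructor
    · rw [h2, h1, zero_add, List.ofFn_succ, List.prod_cons, Nat.factorial_succ, mul_smul_comm,
        mul_smul]
    · rw [pow_succ, h2]; simp

theorem iota_mul_iota_commute {R : Type*} [CommRing R] {M : Type*} [AddCommGroup M]
    [Module R M] (x y z : M) :
    Commute (ExteriorAlgebra.ι R x * ExteriorAlgebra.ι R y) (ExteriorAlgebra.ι R z) := by
  have h (u v : M) : ExteriorAlgebra.ι R u * ExteriorAlgebra.ι R v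
      = - (ExteriorAlgebra.ι R v * ExteriorAlgebra.ι R u) :=
    eq_neg_of_add_eq_zero_left (ExteriorAlgebra.ι_add_mul_swap u v)
  rw [Commute, SemiconjBy, mul_assoc, h y z, mul_neg, ← mul_assoc, h x z, neg_mul, neg_neg,
    mul_assoc]

/-- In the exterior algebra of a module `M` over a commutative ring `R`, for
`x, y : Fin n → M` one has
`(∑ i, ι(x i) * ι(y i))^n = n! • (ι(x 1) * ι(y 1) * ⋯ * ι(x n) * ι(y n))`,
where the product on the right is taken in the order `i = 1, …, n`. -/
theorem sum_iota_mul_iota_pow {R : Type*} [CommRing R] {M : Type*} [AddCommGroup M]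
    [Module R M] (n : ℕ) (hn : 1 ≤ n) (x y : Fin n → M) :
    (∑ i, ExteriorAlgebra.ι R (x i) * ExteriorAlgebra.ι R (y i)) ^ n =
      n.factorial •
        (List.ofFn fun i => ExteriorAlgebra.ι R (x i) * ExteriorAlgebra.ι R (y i)).prod := by

  refine (sum_pow_of_sq_zero n _ (fun i => ?_) (fun i j => ?_)).1
  · rw [← mul_assoc, (iota_mul_iota_commute (R := R) (x i) (y i) (x i)).eq, ← mul_assoc,
      ExteriorAlgebra.ι_sq_zero, zero_mul, zero_mul]
  · exact (iota_mul_iota_commute _ _ _).mul_right (iota_mul_iota_commute _ _ _)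
end

section
/- Let k be a field of characteristic 0, let n ≥ 1, and set B = k[X]/(X^n). Then the universal derivation D : B → Ω¹_{B/k} of the relative Kähler differentials is surjective, and its kernel equals the image of the structure map k → B. (Equivalently, the truncated de Rham complex of B over k satisfies H⁰ = k and the map B → Ω¹_{B/k} is surjective.) -/
open Polynomial

set_option maxHeartbeats 1000000
set_option synthInstance.maxHeartbeats 1000000

/-- The truncated polynomial algebra `B = k[X]/(X^n)`. -/
abbrev TruncatedPoly (k : Type*) [CommRing k] (n : ℕ) : Type _ :=
  k[X] ⧸ Ideal.span {(X : k[X]) ^ n}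

/-- In characteristic zero every polynomial is a derivative. -/
lemma exists_derivative_eq (k : Type*) [Field k] [CharZero k] (p : k[X]) :
    ∃ q : k[X], derivative q = p := by
  induction p using Polynomial.induction_on' with
  | add p q hp hq =>
    obtain ⟨a, rfl⟩ := hp
    obtain ⟨b, rfl⟩ := hq
    exact ⟨a + b, derivative_add⟩
  | monomial m a =>
    refine ⟨monomial (m + 1) (a / ((m : k) + 1)), ?_⟩
    have h : (m : k) + 1 ≠ 0 := Nat.cast_add_one_ne_zero m
    rw [derivative_monomial]
    simp [h]

lemma euler_coeff (k : Type*) [Field k] (p : k[X]) (d : ℕ) :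
    (X * derivative p).coeff d = p.coeff d * d := by
  cases d with
  | zero => simp
  | succ d => rw [coeff_X_mul, coeff_derivative]; push_cast; rfl

lemma truncatedPoly_mk_eq_zero (k : Type*) [Field k] (n : ℕ) (p : k[X]) :
    Ideal.Quotient.mkₐ k (Ideal.span {(X : k[X]) ^ n}) p = 0 ↔ ∀ d < n, p.coeff d = 0 := by
  rw [Ideal.Quotient.mkₐ_eq_mk, Ideal.Quotient.eq_zero_iff_mem, Ideal.mem_span_singleton,
    X_pow_dvd_iff]

/-- For a field `k` of characteristic `0` and `n ≥ 1`, the universal derivation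
`D : B → Ω¹_{B/k}` of `B = k[X]/(X^n)` is surjective and its kernel is exactly the image
of the structure map `k → B`; i.e. the truncated de Rham complex of `B` over `k` has
`H⁰ = k` and `B → Ω¹_{B/k}` surjective. -/
theorem truncatedPoly_D_surjective_and_ker (k : Type*) [Field k] [CharZero k]
    (n : ℕ) (hn : 1 ≤ n) :
    Function.Surjective (KaehlerDifferential.D k (TruncatedPoly k n)) ∧
    ∀ b : TruncatedPoly k n,
      KaehlerDifferential.D k (TruncatedPoly k n) b = 0 ↔
        b ∈ Set.range (algebraMap k (TruncatedPoly k n)) := by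
  constructor
  · intro w
    obtain ⟨v, rfl⟩ := KaehlerDifferential.map_surjective_of_surjective k k k[X]
      (TruncatedPoly k n) Ideal.Quotient.mk_surjective w
    obtain ⟨q, hq⟩ := exists_derivative_eq k (KaehlerDifferential.polynomialEquiv k v)
    refine ⟨algebraMap k[X] (TruncatedPoly k n) q, ?_⟩
    rw [← KaehlerDifferential.map_D k k k[X] (TruncatedPoly k n)]
    congr 1
    apply (KaehlerDifferential.polynomialEquiv k).injective
    rw [KaehlerDifferential.polynomialEquiv_D, hq]
  · intro b
    constructor
    · intro hb
      have hs := Ideal.Quotient.mkₐ_surjective k (Ideal.span {(X : k[X]) ^ n})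
      obtain ⟨p, rfl⟩ := hs b
      let E : Derivation k k[X] k[X] := (X : k[X]) • derivative'
      have hE : ∀ p, E p = X * derivative p := fun p => rfl
      have hd : ∀ p, Ideal.Quotient.mkₐ k (Ideal.span {(X : k[X]) ^ n}) p = 0 →
          Ideal.Quotient.mkₐ k (Ideal.span {(X : k[X]) ^ n}) (E p) = 0 := by
        intro p hp
        rw [truncatedPoly_mk_eq_zero] at hp ⊢
        intro d hdn
        rw [hE, euler_coeff, hp d hdn, zero_mul]
      have h1 := (Derivation.liftOfSurjective hs hd).liftKaehlerDifferential_comp_D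
        (Ideal.Quotient.mkₐ k (Ideal.span {(X : k[X]) ^ n}) p)
      rw [hb, map_zero, Derivation.liftOfSurjective_apply] at h1
      have h2 := (truncatedPoly_mk_eq_zero k n _).1 h1.symm
      refine ⟨p.coeff 0, ?_⟩
      rw [← (Ideal.Quotient.mkₐ k (Ideal.span {(X : k[X]) ^ n})).commutes, eq_comm, ← sub_eq_zero,
        ← map_sub, truncatedPoly_mk_eq_zero]
      intro d hdn
      have h3 := h2 d hdn
      rw [hE, euler_coeff] at h3
      cases d with
      | zero => simp
      | succ d =>
        have : p.coeff (d + 1) = 0 :=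
          (mul_eq_zero.1 h3).resolve_right (Nat.cast_ne_zero.2 d.succ_ne_zero)
        simp [this, Polynomial.algebraMap_apply, coeff_C]
    · rintro ⟨a, rfl⟩
      exact Derivation.map_algebraMap _ a
end

section
/- Let (A_n)_{n∈ℕ} be an inverse system of additive commutative groups with transition homomorphisms π_n : A_{n+1} → A_n. Assume that for every n the map A_{n+1} → A_n ×_{ℚ⊗A_n} (ℚ⊗A_{n+1}) is surjective, i.e., for all a ∈ A_n and x ∈ ℚ ⊗_ℤ A_{n+1} with (π_n)_ℚ(x) = 1 ⊗ a there exists b ∈ A_{n+1} with π_n(b) = a and 1 ⊗ b = x. Then the canonical map (lim_n A_n) ⊗_ℤ ℚ → lim_n (A_n ⊗_ℤ ℚ) is surjective: for every family (x_n)_n with x_n ∈ ℚ ⊗_ℤ A_n and (π_n)_ℚ(x_{n+1}) = x_n for all n, there exist a compatible family (a_n)_n with a_n ∈ A_n and π_n(a_{n+1}) = a_n, and a positive integer m, such that 1 ⊗ a_n = m • x_n for all n. -/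
open scoped TensorProduct

theorem exists_nat_smul_eq_one_tmul {M : Type*} [AddCommGroup M] (x : ℚ ⊗[ℤ] M) :
    ∃ (m : ℕ) (a : M), 0 < m ∧ (1 : ℚ) ⊗ₜ[ℤ] a = m • x := by
  induction x using TensorProduct.induction_on with
  | zero => exact ⟨1, 0, one_pos, by simp⟩
  | tmul q a =>
    refine ⟨q.den, q.num • a, q.den_pos, ?_⟩
    rw [← TensorProduct.smul_tmul, TensorProduct.smul_tmul']
    congr 1
    rw [zsmul_eq_mul, nsmul_eq_mul, mul_one, Rat.den_mul_eq_num]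
  | add x y hx hy =>
    obtain ⟨m, a, hm, ha⟩ := hx
    obtain ⟨k, b, hk, hb⟩ := hy
    refine ⟨m * k, k • a + m • b, Nat.mul_pos hm hk, ?_⟩
    have e (j : ℕ) (c : M) : (1 : ℚ) ⊗ₜ[ℤ] (j • c) = j • ((1 : ℚ) ⊗ₜ[ℤ] c) :=
      map_nsmul (TensorProduct.mk ℤ ℚ M 1) j c
    rw [TensorProduct.tmul_add, e, e, ha, hb, smul_add, mul_smul, mul_smul,
      smul_comm k m x]

/-- Claim 5.3 of the paper, abstractly: let `(A_n)` be an inverse system of abelian groups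
with transition maps `π_n : A_{n+1} → A_n` such that each map
`A_{n+1} → A_n ×_{ℚ⊗A_n} (ℚ⊗A_{n+1})` is surjective. Then
`(lim_n A_n) ⊗ ℚ → lim_n (A_n ⊗ ℚ)` is surjective: every compatible family `(x_n)` with
`x_n ∈ ℚ ⊗ A_n` comes, up to a positive integer multiple `m`, from a compatible family
`(a_n)` with `a_n ∈ A_n`, in the sense that `1 ⊗ a_n = m • x_n` for all `n`. -/
theorem limit_rationalization_surjective (A : ℕ → Type*) [∀ n, AddCommGroup (A n)]
    (π : ∀ n : ℕ, A (n + 1) →+ A n)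
    (hsurj : ∀ (n : ℕ) (a : A n) (x : ℚ ⊗[ℤ] A (n + 1)),
      LinearMap.lTensor ℚ (π n).toIntLinearMap x = (1 : ℚ) ⊗ₜ[ℤ] a →
      ∃ b : A (n + 1), π n b = a ∧ (1 : ℚ) ⊗ₜ[ℤ] b = x)
    (x : ∀ n : ℕ, ℚ ⊗[ℤ] A n)
    (hx : ∀ n : ℕ, LinearMap.lTensor ℚ (π n).toIntLinearMap (x (n + 1)) = x n) :
    ∃ (a : ∀ n : ℕ, A n) (m : ℕ), 0 < m ∧ (∀ n : ℕ, π n (a (n + 1)) = a n) ∧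
      ∀ n : ℕ, (1 : ℚ) ⊗ₜ[ℤ] a n = m • x n := by
  obtain ⟨m, a0, hm, h0⟩ := exists_nat_smul_eq_one_tmul (x 0)
  have step (n : ℕ) (a : {a : A n // (1 : ℚ) ⊗ₜ[ℤ] a = m • x n}) :
      ∃ b : {b : A (n + 1) // (1 : ℚ) ⊗ₜ[ℤ] b = m • x (n + 1)}, π n b.1 = a.1 := by
    obtain ⟨b, h1, h2⟩ := hsurj n a.1 (m • x (n + 1)) (by rw [map_nsmul, hx, a.2])
    exact ⟨⟨b, h2⟩, h1⟩
  choose f hf using step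
  let F : ∀ n : ℕ, {a : A n // (1 : ℚ) ⊗ₜ[ℤ] a = m • x n} :=
    fun n => Nat.rec ⟨a0, h0⟩ (fun n a => f n a) n
  exact ⟨fun n => (F n).1, m, hm, fun n => hf n (F n), fun n => (F n).2⟩
end
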